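/- Let α₁, α₂, β₁, β₂ > 0 and γ ∈ ℝ, and set a(u) = u^{α₁/(2(α₁+α₂))} and A(u) = u^{2α₁/(α₁+α₂)}. Then ∫_{a(u)}^{A(u)} x^γ exp( −β₁ u^{α₁}/x^{α₁} − β₂ x^{α₂} ) dx = C u^δ exp(−β₃ u^{α₃}) (1 + o(1)) as u → ∞, where α₃ = α₁α₂/(α₁+α₂), β₃ = β₁^{α₂/(α₁+α₂)} β₂^{α₁/(α₁+α₂)} [ (α₁/α₂)^{α₂/(α₁+α₂)} + (α₂/α₁)^{α₁/(α₁+α₂)} ], δ = α₁(−α₂ + 2γ + 2)/(2(α₁+α₂)), and C = √(2π) (α₁+α₂)^{-1/2} (α₁β₁)^{(−α₂ + 2γ + 2)/(2(α₁+α₂))} (α₂β₂)^{(−α₁ − 2γ − 2)/(2(α₁+α₂))}. -/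

import Mathlib

open MeasureTheory Filter Set

noncomputable section

/-- The quadratic lower bound for the phase function `exp (-a t) / a + exp (b t) / b`. -/
lemma min_mul_sq_le_exp_phase {a b : ℝ} (ha : 0 < a) (hb : 0 < b) (t : ℝ) :
    min a b / 2 * t ^ 2 ≤
      (Real.exp (-(a * t)) - 1) / a + (Real.exp (b * t) - 1) / b := by
  have ea : (Real.exp (-(a * t)) - 1) / a ≥ -t := by
    rw [ge_iff_le, le_div_iff₀ ha]
    linarith [Real.add_one_le_exp (-(a * t))]
  have eb : (Real.exp (b * t) - 1) / b ≥ t := by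
    rw [ge_iff_le, le_div_iff₀ hb]
    linarith [Real.add_one_le_exp (b * t)]
  rcases le_total 0 t with ht | ht
  · have h := Real.quadratic_le_exp_of_nonneg (mul_nonneg hb.le ht)
    have eb' : t + b / 2 * t ^ 2 ≤ (Real.exp (b * t) - 1) / b := by
      rw [le_div_iff₀ hb]
      linarith
    have := mul_le_mul_of_nonneg_right (min_le_right a b) (sq_nonneg t)
    linarith
  · have h := Real.quadratic_le_exp_of_nonneg (x := -(a * t)) (by nlinarith)
    have ea' : -t + a / 2 * t ^ 2 ≤ (Real.exp (-(a * t)) - 1) / a := by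
      rw [le_div_iff₀ ha]
      linarith
    have := mul_le_mul_of_nonneg_right (min_le_left a b) (sq_nonneg t)
    linarith

lemma tendsto_sq_mul_exp_div_sub (c : ℝ) :
    Tendsto (fun r : ℝ => r ^ 2 * (Real.exp (c / r) - 1 - c / r)) atTop (nhds (c ^ 2 / 2)) := by
  rw [tendsto_iff_norm_sub_tendsto_zero]
  refine squeeze_zero' (g := fun r : ℝ => |c| ^ 3 / r) (Eventually.of_forall fun r => norm_nonneg _)
    ?_ (tendsto_const_nhds.div_atTop tendsto_id)
  filter_upwards [eventually_gt_atTop 0, eventually_ge_atTop |c|] with r hr hc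
  have h1 : |c / r| ≤ 1 := by
    rw [abs_div, abs_of_pos hr]
    exact (div_le_one hr).2 hc
  have h := Real.exp_bound h1 (n := 3) (by norm_num)
  simp only [Finset.sum_range_succ, Finset.sum_range_zero, Nat.factorial] at h
  norm_num at h
  have e : r ^ 2 * (Real.exp (c / r) - 1 - c / r) - c ^ 2 / 2 =
      r ^ 2 * (Real.exp (c / r) - (1 + c / r + (c / r) ^ 2 / 2)) := by
    field_simp
    ring
  rw [e, Real.norm_eq_abs, abs_mul, abs_of_pos (pow_pos hr 2)]
  calc _ ≤ r ^ 2 * (|c / r| ^ 3 * 1) := by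
        gcongr
        refine h.trans ?_
        rw [abs_div]
        gcongr
        norm_num
    _ = |c| ^ 3 / r := by
        rw [abs_div, abs_of_pos hr]
        field_simp

lemma tendsto_sq_mul_exp_phase {a b : ℝ} (ha : 0 < a) (hb : 0 < b) (y : ℝ) :
    Tendsto (fun r : ℝ => r ^ 2 *
        ((Real.exp (-(a * (y / r))) - 1) / a + (Real.exp (b * (y / r)) - 1) / b))
      atTop (nhds ((a + b) / 2 * y ^ 2)) := by
  have h := ((tendsto_sq_mul_exp_div_sub (-(a * y))).div_const a).add
    ((tendsto_sq_mul_exp_div_sub (b * y)).div_const b)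
  have e : (-(a * y)) ^ 2 / 2 / a + (b * y) ^ 2 / 2 / b = (a + b) / 2 * y ^ 2 := by
    field_simp
  rw [e] at h
  refine h.congr fun r => ?_
  rw [show -(a * y) / r = -(a * (y / r)) by ring, show b * y / r = b * (y / r) by ring]
  field_simp
  ring

lemma integrable_exp_mul_abs_sub_mul_sq (k : ℝ) {c : ℝ} (hc : 0 < c) :
    Integrable fun y : ℝ => Real.exp (k * |y| - c * y ^ 2) := by
  refine ((integrable_exp_neg_mul_sq (half_pos hc)).const_mul
    (Real.exp (k ^ 2 / (2 * c)))).mono' (by fun_prop) (Eventually.of_forall fun y => ?_)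
  rw [Real.norm_eq_abs, Real.abs_exp, ← Real.exp_add]
  gcongr
  have e : k ^ 2 / (2 * c) + -(c / 2) * y ^ 2 - (k * |y| - c * y ^ 2) =
      (k - c * |y|) ^ 2 / (2 * c) := by
    rw [← sq_abs y]
    field_simp
    ring
  have : 0 ≤ (k - c * |y|) ^ 2 / (2 * c) := by positivity
  linarith

/-- The Laplace method for the phase `exp (-a t) / a + exp (b t) / b`, after rescaling. -/
lemma tendsto_intervalIntegral_exp_phase {ι : Type*} {l : Filter ι} [l.IsCountablyGenerated]
    {a b : ℝ} (ha : 0 < a) (hb : 0 < b) (k : ℝ) {r lo hi : ι → ℝ}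
    (hr : Tendsto r l atTop) (hlo : Tendsto lo l atBot) (hhi : Tendsto hi l atTop) :
    Tendsto (fun i => ∫ y in (lo i)..(hi i), Real.exp (k * (y / r i) - r i ^ 2 *
        ((Real.exp (-(a * (y / r i))) - 1) / a + (Real.exp (b * (y / r i)) - 1) / b)))
      l (nhds (Real.sqrt (2 * Real.pi / (a + b)))) := by
  set F : ι → ℝ → ℝ := fun i y => Real.exp (k * (y / r i) - r i ^ 2 *
        ((Real.exp (-(a * (y / r i))) - 1) / a + (Real.exp (b * (y / r i)) - 1) / b)) with hF
  have hm : 0 < min a b / 2 := by positivity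
  have key : Tendsto (fun i => ∫ y, (Ioc (lo i) (hi i)).indicator (F i) y) l
      (nhds (∫ y : ℝ, Real.exp (-((a + b) / 2) * y ^ 2))) := by
    refine tendsto_integral_filter_of_dominated_convergence
      (fun y => Real.exp (|k| * |y| - min a b / 2 * y ^ 2)) ?_ ?_
      (integrable_exp_mul_abs_sub_mul_sq _ hm) ?_
    · refine Eventually.of_forall fun i => ?_
      refine AEStronglyMeasurable.indicator ?_ measurableSet_Ioc
      exact Measurable.aestronglyMeasurable (by simp only [hF]; fun_prop)
    · filter_upwards [hr.eventually_ge_atTop 1] with i hi1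
      refine Eventually.of_forall fun y => (norm_indicator_le_norm_self _ _).trans ?_
      have hr0 : 0 < r i := by linarith
      rw [Real.norm_eq_abs, Real.abs_exp]
      refine Real.exp_le_exp.2 (sub_le_sub ?_ ?_)
      · refine (le_abs_self _).trans ?_
        rw [abs_mul, abs_div, abs_of_pos hr0]
        gcongr
        exact div_le_self (abs_nonneg y) hi1
      · refine le_of_eq_of_le ?_ (mul_le_mul_of_nonneg_left
          (min_mul_sq_le_exp_phase ha hb (y / r i)) (sq_nonneg (r i)))
        field_simp
    · refine Eventually.of_forall fun y => ?_
      have h1 : Tendsto (fun i => F i y) l (nhds (Real.exp (-((a + b) / 2) * y ^ 2))) := by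
        refine (Real.continuous_exp.tendsto _).comp ?_
        have h2 : Tendsto (fun i => k * (y / r i)) l (nhds (k * 0)) :=
          (tendsto_const_nhds.div_atTop hr).const_mul k
        have h3 := h2.sub ((tendsto_sq_mul_exp_phase ha hb y).comp hr)
        rw [show k * 0 - (a + b) / 2 * y ^ 2 = -((a + b) / 2) * y ^ 2 by ring] at h3
        exact h3
      refine h1.congr' ?_
      filter_upwards [hlo.eventually_lt_atBot y, hhi.eventually_ge_atTop y] with i h3 h4
      rw [indicator_of_mem (mem_Ioc.2 ⟨h3, h4⟩)]
  rw [integral_gaussian, show Real.pi / ((a + b) / 2) = 2 * Real.pi / (a + b) by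
    field_simp] at key
  refine key.congr' ?_
  filter_upwards [hlo.eventually_le_atBot 0, hhi.eventually_ge_atTop 0] with i h3 h4
  rw [intervalIntegral.integral_of_le (h3.trans h4), integral_indicator measurableSet_Ioc]

/-- The substitution `x = x₀ * exp (y / r)` centred at the critical point `x₀` of the phase. -/
lemma intervalIntegral_rpow_mul_exp_eq {a b x₀ r p q : ℝ} (γ : ℝ) (ha : 0 < a) (hb : 0 < b)
    (hx₀ : 0 < x₀) (hr : 0 < r) (hp : 0 < p) (hq : 0 < q) :
    ∫ x in p..q, x ^ γ *
        Real.exp (-(r ^ 2 / a * x₀ ^ a) / x ^ a - r ^ 2 / b / x₀ ^ b * x ^ b) =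
      x₀ ^ (γ + 1) / r * Real.exp (-(r ^ 2 / a + r ^ 2 / b)) *
        ∫ y in (r * Real.log (p / x₀))..(r * Real.log (q / x₀)),
          Real.exp ((γ + 1) * (y / r) - r ^ 2 *
            ((Real.exp (-(a * (y / r))) - 1) / a + (Real.exp (b * (y / r)) - 1) / b)) := by
  set g : ℝ → ℝ := fun y => x₀ * Real.exp (y / r) with hg
  have hgpos : ∀ y, 0 < g y := fun y => mul_pos hx₀ (Real.exp_pos _)
  have hgend : ∀ z, 0 < z → g (r * Real.log (z / x₀)) = z := by
    intro z hz
    simp only [hg]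
    rw [mul_div_cancel_left₀ _ hr.ne', Real.exp_log (by positivity)]
    field_simp
  have hgrpow : ∀ y c, g y ^ c = x₀ ^ c * Real.exp (c * (y / r)) := by
    intro y c
    simp only [hg]
    rw [Real.mul_rpow hx₀.le (Real.exp_pos _).le, ← Real.exp_mul, mul_comm (y / r)]
  set f : ℝ → ℝ := fun x => x ^ γ *
        Real.exp (-(r ^ 2 / a * x₀ ^ a) / x ^ a - r ^ 2 / b / x₀ ^ b * x ^ b) with hf
  have hsub := intervalIntegral.integral_comp_mul_deriv'' (f := g)
    (f' := fun y => x₀ * (Real.exp (y / r) * (1 / r))) (g := f)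
    (a := r * Real.log (p / x₀)) (b := r * Real.log (q / x₀))
    (by simp only [hg]; fun_prop)
    (fun y _ => ((((hasDerivAt_id y).div_const r).exp).const_mul x₀).hasDerivWithinAt)
    (by fun_prop)
    (by
      rintro _ ⟨y, -, rfl⟩
      have h0 := (hgpos y).ne'
      have hc : ∀ c : ℝ, ContinuousAt (fun x : ℝ => x ^ c) (g y) := fun c =>
        Real.continuousAt_rpow_const _ _ (Or.inl h0)
      have h1 : g y ^ a ≠ 0 := (Real.rpow_pos_of_pos (hgpos y) a).ne'
      exact ((hc γ).mul (((continuousAt_const.div (hc a) h1).sub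
        (continuousAt_const.mul (hc b))).rexp)).continuousWithinAt)
  rw [hgend p hp, hgend q hq] at hsub
  rw [← hsub, ← intervalIntegral.integral_const_mul]
  refine intervalIntegral.integral_congr fun y _ => ?_
  simp only [Function.comp_apply, hf, hgrpow]
  have ea : -(r ^ 2 / a * x₀ ^ a) / (x₀ ^ a * Real.exp (a * (y / r))) =
      -(r ^ 2 / a * Real.exp (-(a * (y / r)))) := by
    rw [Real.exp_neg]
    have := (Real.rpow_pos_of_pos hx₀ a).ne'
    field_simp
  have eb : r ^ 2 / b / x₀ ^ b * (x₀ ^ b * Real.exp (b * (y / r))) =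
      r ^ 2 / b * Real.exp (b * (y / r)) := by
    have := (Real.rpow_pos_of_pos hx₀ b).ne'
    field_simp
  rw [ea, eb, Real.rpow_add hx₀, Real.rpow_one]
  have e : Real.exp (-(r ^ 2 / a + r ^ 2 / b)) * Real.exp ((γ + 1) * (y / r) - r ^ 2 *
            ((Real.exp (-(a * (y / r))) - 1) / a + (Real.exp (b * (y / r)) - 1) / b)) =
      Real.exp (γ * (y / r)) * Real.exp (-(r ^ 2 / a * Real.exp (-(a * (y / r)))) -
        r ^ 2 / b * Real.exp (b * (y / r))) * Real.exp (y / r) := by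
    rw [← Real.exp_add, ← Real.exp_add, ← Real.exp_add]
    congr 1
    ring
  rw [mul_assoc (x₀ ^ γ * x₀ / r), e]
  ring

/-- Lemma 4.2: exact asymptotics of the Laplace-type integral
`∫_{a(u)}^{A(u)} x^γ exp(-β₁ u^{α₁}/x^{α₁} - β₂ x^{α₂}) dx` as `u → ∞`,
where `a(u) = u^{α₁/(2(α₁+α₂))}` and `A(u) = u^{2α₁/(α₁+α₂)}`. -/
theorem laplace_integral_asymptotics
    (α₁ α₂ β₁ β₂ γ : ℝ)
    (hα₁ : 0 < α₁) (hα₂ : 0 < α₂) (hβ₁ : 0 < β₁) (hβ₂ : 0 < β₂) :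
    Tendsto (fun u : ℝ =>
        (∫ x in (u ^ (α₁ / (2 * (α₁ + α₂))))..(u ^ (2 * α₁ / (α₁ + α₂))),
          x ^ γ * Real.exp (-(β₁ * u ^ α₁) / x ^ α₁ - β₂ * x ^ α₂)) /
        ((Real.sqrt (2 * Real.pi) * (α₁ + α₂) ^ (-(1 : ℝ) / 2) *
            (α₁ * β₁) ^ ((-α₂ + 2 * γ + 2) / (2 * (α₁ + α₂))) *
            (α₂ * β₂) ^ ((-α₁ - 2 * γ - 2) / (2 * (α₁ + α₂)))) *
          u ^ (α₁ * (-α₂ + 2 * γ + 2) / (2 * (α₁ + α₂))) *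
          Real.exp (-(β₁ ^ (α₂ / (α₁ + α₂)) * β₂ ^ (α₁ / (α₁ + α₂)) *
              ((α₁ / α₂) ^ (α₂ / (α₁ + α₂)) + (α₂ / α₁) ^ (α₁ / (α₁ + α₂)))) *
            u ^ (α₁ * α₂ / (α₁ + α₂)))))
      atTop (nhds 1) := by
  have hs : 0 < α₁ + α₂ := by positivity
  set X : ℝ → ℝ := fun u =>
    (α₁ * β₁ / (α₂ * β₂)) ^ (1 / (α₁ + α₂)) * u ^ (α₁ / (α₁ + α₂)) with hX
  set R : ℝ → ℝ := fun u => (α₂ * β₂ * X u ^ α₂) ^ ((1 : ℝ) / 2) with hR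
  have hK : 0 < (α₁ * β₁ / (α₂ * β₂)) ^ (1 / (α₁ + α₂)) := by positivity
  have hXtop : Tendsto X atTop atTop :=
    (tendsto_rpow_atTop (by positivity)).const_mul_atTop hK
  have hRtop : Tendsto R atTop atTop :=
    (tendsto_rpow_atTop (by norm_num)).comp
      (((tendsto_rpow_atTop hα₂).comp hXtop).const_mul_atTop (by positivity))
  have hXpos : ∀ u, 0 < u → 0 < X u := fun u hu => by positivity
  have hRpos : ∀ u, 0 < u → 0 < R u := fun u hu => by
    have := hXpos u hu
    positivity
  have hlog : ∀ u, 0 < u → Real.log (X u) =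
      (Real.log α₁ + Real.log β₁ - Real.log α₂ - Real.log β₂ + α₁ * Real.log u) / (α₁ + α₂) := by
    intro u hu
    simp only [hX]
    rw [Real.log_mul (by positivity) (by positivity), Real.log_rpow (by positivity),
      Real.log_rpow hu, Real.log_div (by positivity) (by positivity),
      Real.log_mul (by positivity) (by positivity), Real.log_mul (by positivity) (by positivity)]
    field_simp
    ring
  have hlogR : ∀ u, 0 < u → Real.log (R u) =
      (Real.log α₂ + Real.log β₂ + α₂ * Real.log (X u)) / 2 := by
    intro u hu
    have := hXpos u hu
    simp only [hR]
    rw [Real.log_rpow (by positivity), Real.log_mul (by positivity) (by positivity),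
      Real.log_mul (by positivity) (by positivity), Real.log_rpow this]
    ring
  have hR2 : ∀ u, 0 < u → R u ^ 2 = α₂ * β₂ * X u ^ α₂ := by
    intro u hu
    have := hXpos u hu
    simp only [hR]
    rw [← Real.rpow_natCast, ← Real.rpow_mul (by positivity)]
    norm_num
  have hcoef₁ : ∀ u, 0 < u → R u ^ 2 / α₁ * X u ^ α₁ = β₁ * u ^ α₁ := by
    intro u hu
    have h := hXpos u hu
    rw [hR2 u hu]
    refine Real.log_injOn_pos (mem_Ioi.2 (by positivity)) (mem_Ioi.2 (by positivity)) ?_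
    rw [Real.log_mul (by positivity) (by positivity), Real.log_div (by positivity) (by positivity),
      Real.log_mul (by positivity) (by positivity), Real.log_mul (by positivity) (by positivity),
      Real.log_mul (by positivity) (by positivity), Real.log_rpow h, Real.log_rpow h,
      Real.log_rpow hu, hlog u hu]
    field_simp
    ring
  have hcoef₂ : ∀ u, 0 < u → R u ^ 2 / α₂ / X u ^ α₂ = β₂ := by
    intro u hu
    have h := hXpos u hu
    rw [hR2 u hu]
    field_simp
  have hexp₂ : ∀ u, 0 < u → R u ^ 2 / α₂ = β₁ ^ (α₂ / (α₁ + α₂)) * β₂ ^ (α₁ / (α₁ + α₂)) *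
      (α₁ / α₂) ^ (α₂ / (α₁ + α₂)) * u ^ (α₁ * α₂ / (α₁ + α₂)) := by
    intro u hu
    have h := hRpos u hu
    refine Real.log_injOn_pos (mem_Ioi.2 (by positivity)) (mem_Ioi.2 (by positivity)) ?_
    rw [Real.log_div (by positivity) (by positivity), Real.log_pow, hlogR u hu, hlog u hu,
      Real.log_mul (by positivity) (by positivity), Real.log_mul (by positivity) (by positivity),
      Real.log_mul (by positivity) (by positivity), Real.log_rpow hβ₁, Real.log_rpow hβ₂,
      Real.log_rpow (by positivity), Real.log_rpow hu, Real.log_div (by positivity) (by positivity)]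
    push_cast
    field_simp
    ring
  have hexp₁ : ∀ u, 0 < u → R u ^ 2 / α₁ = β₁ ^ (α₂ / (α₁ + α₂)) * β₂ ^ (α₁ / (α₁ + α₂)) *
      (α₂ / α₁) ^ (α₁ / (α₁ + α₂)) * u ^ (α₁ * α₂ / (α₁ + α₂)) := by
    intro u hu
    have h := hRpos u hu
    refine Real.log_injOn_pos (mem_Ioi.2 (by positivity)) (mem_Ioi.2 (by positivity)) ?_
    rw [Real.log_div (by positivity) (by positivity), Real.log_pow, hlogR u hu, hlog u hu,
      Real.log_mul (by positivity) (by positivity), Real.log_mul (by positivity) (by positivity),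
      Real.log_mul (by positivity) (by positivity), Real.log_rpow hβ₁, Real.log_rpow hβ₂,
      Real.log_rpow (by positivity), Real.log_rpow hu, Real.log_div (by positivity) (by positivity)]
    push_cast
    field_simp
    ring
  have hpref : ∀ u, 0 < u → X u ^ (γ + 1) / R u =
      (α₁ * β₁) ^ ((-α₂ + 2 * γ + 2) / (2 * (α₁ + α₂))) *
        (α₂ * β₂) ^ ((-α₁ - 2 * γ - 2) / (2 * (α₁ + α₂))) *
        u ^ (α₁ * (-α₂ + 2 * γ + 2) / (2 * (α₁ + α₂))) := by
    intro u hu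
    have h := hRpos u hu
    have h' := hXpos u hu
    refine Real.log_injOn_pos (mem_Ioi.2 (by positivity)) (mem_Ioi.2 (by positivity)) ?_
    rw [Real.log_div (by positivity) (by positivity), hlogR u hu, Real.log_rpow h', hlog u hu,
      Real.log_mul (by positivity) (by positivity), Real.log_mul (by positivity) (by positivity),
      Real.log_rpow (by positivity), Real.log_rpow (by positivity), Real.log_rpow hu,
      Real.log_mul (by positivity) (by positivity), Real.log_mul (by positivity) (by positivity)]
    field_simp
    ring
  have hlogend : ∀ e : ℝ, ∀ u, 0 < u → Real.log (u ^ e / X u) =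
      (e - α₁ / (α₁ + α₂)) * Real.log u -
        (Real.log α₁ + Real.log β₁ - Real.log α₂ - Real.log β₂) / (α₁ + α₂) := by
    intro e u hu
    have h := hXpos u hu
    rw [Real.log_div (by positivity) (by positivity), Real.log_rpow hu, hlog u hu]
    field_simp
    ring
  have hlo : Tendsto (fun u => R u * Real.log (u ^ (α₁ / (2 * (α₁ + α₂))) / X u))
      atTop atBot := by
    refine hRtop.atTop_mul_atBot₀ ?_
    have hneg : α₁ / (2 * (α₁ + α₂)) - α₁ / (α₁ + α₂) < 0 := by
      have : α₁ / (2 * (α₁ + α₂)) - α₁ / (α₁ + α₂) = -(α₁ / (2 * (α₁ + α₂))) := by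
        field_simp
        ring
      rw [this, neg_lt_zero]
      positivity
    have h := tendsto_atBot_add_const_right atTop
      (-((Real.log α₁ + Real.log β₁ - Real.log α₂ - Real.log β₂) / (α₁ + α₂)))
      (Real.tendsto_log_atTop.const_mul_atTop_of_neg hneg)
    refine h.congr' ?_
    filter_upwards [eventually_gt_atTop 0] with u hu
    rw [hlogend _ u hu, ← sub_eq_add_neg]
  have hhi : Tendsto (fun u => R u * Real.log (u ^ (2 * α₁ / (α₁ + α₂)) / X u))
      atTop atTop := by
    refine hRtop.atTop_mul_atTop₀ ?_
    have hpos : 0 < 2 * α₁ / (α₁ + α₂) - α₁ / (α₁ + α₂) := by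
      have : 2 * α₁ / (α₁ + α₂) - α₁ / (α₁ + α₂) = α₁ / (α₁ + α₂) := by
        field_simp
        ring
      rw [this]
      positivity
    have h := tendsto_atTop_add_const_right atTop
      (-((Real.log α₁ + Real.log β₁ - Real.log α₂ - Real.log β₂) / (α₁ + α₂)))
      (Real.tendsto_log_atTop.const_mul_atTop hpos)
    refine h.congr' ?_
    filter_upwards [eventually_gt_atTop 0] with u hu
    rw [hlogend _ u hu, ← sub_eq_add_neg]
  have hsqrt : Real.sqrt (2 * Real.pi) * (α₁ + α₂) ^ (-(1 : ℝ) / 2) =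
      Real.sqrt (2 * Real.pi / (α₁ + α₂)) := by
    rw [Real.sqrt_div (by positivity), Real.sqrt_eq_rpow (α₁ + α₂), neg_div,
      Real.rpow_neg hs.le, ← div_eq_mul_inv]
  have hlim := (tendsto_intervalIntegral_exp_phase hα₁ hα₂ (γ + 1) hRtop hlo hhi).div_const
    (Real.sqrt (2 * Real.pi / (α₁ + α₂)))
  have hsq : 0 < Real.sqrt (2 * Real.pi / (α₁ + α₂)) := Real.sqrt_pos.2 (by positivity)
  rw [div_self hsq.ne'] at hlim
  refine hlim.congr' ?_
  filter_upwards [eventually_gt_atTop 0] with u hu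
  have hx := hXpos u hu
  have hr := hRpos u hu
  have hsubst := intervalIntegral_rpow_mul_exp_eq γ hα₁ hα₂ hx hr
    (Real.rpow_pos_of_pos hu (α₁ / (2 * (α₁ + α₂))))
    (Real.rpow_pos_of_pos hu (2 * α₁ / (α₁ + α₂)))
  rw [hcoef₁ u hu, hcoef₂ u hu] at hsubst
  have hden : Real.sqrt (2 * Real.pi) * (α₁ + α₂) ^ (-(1 : ℝ) / 2) *
            (α₁ * β₁) ^ ((-α₂ + 2 * γ + 2) / (2 * (α₁ + α₂))) *
            (α₂ * β₂) ^ ((-α₁ - 2 * γ - 2) / (2 * (α₁ + α₂))) *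
          u ^ (α₁ * (-α₂ + 2 * γ + 2) / (2 * (α₁ + α₂))) *
          Real.exp (-(β₁ ^ (α₂ / (α₁ + α₂)) * β₂ ^ (α₁ / (α₁ + α₂)) *
              ((α₁ / α₂) ^ (α₂ / (α₁ + α₂)) + (α₂ / α₁) ^ (α₁ / (α₁ + α₂)))) *
            u ^ (α₁ * α₂ / (α₁ + α₂))) =
      X u ^ (γ + 1) / R u * Real.exp (-(R u ^ 2 / α₁ + R u ^ 2 / α₂)) *
        Real.sqrt (2 * Real.pi / (α₁ + α₂)) := by
    rw [hsqrt, hpref u hu, hexp₁ u hu, hexp₂ u hu]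
    ring_nf
  rw [hsubst, hden, mul_div_mul_left _ _ (by positivity)]
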